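/- arXiv:2208.10521 — 2 statements merged into one kernel-verified Lean document; each statement's English description precedes it below -/
import Mathlib

section
/- Fix ℓ ≥ 2. If μ̃ is a level-ℓ pseudo-distribution in the variables (ω, x) satisfying T_{ω,x} at degree 0 such that ‖Ẽ_μ̃[ω]‖ ≤ ‖Ẽ_ν[ω]‖ for every level-ℓ pseudo-distribution ν satisfying T_{ω,x} at degree 0 (where Ẽ[ω] ∈ ℝⁿ denotes the vector with entries Ẽ[ω_i] and ‖·‖ the Euclidean norm), then ∑_{i∈I} Ẽ_μ̃[ω_i] ≥ α²·n. -/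
open scoped BigOperators
open MvPolynomial

noncomputable section

/-- A polynomial is a sum of squares. -/
def IsSOS {V : Type*} (p : MvPolynomial V ℝ) : Prop :=
  ∃ (N : ℕ) (q : Fin N → MvPolynomial V ℝ), p = ∑ j, q j ^ 2

/-- A degree-`k` sum-of-squares proof that the system `{A i ≥ 0}` implies `g ≥ 0`:
a family of sos polynomials `P S`, indexed by the subsets `S` of the constraint
indices, with `g = ∑_S P S · ∏_{i∈S} A i` and every summand of degree at most `k`. -/
def SosProof {V ι : Type*} [Fintype ι] [DecidableEq ι]
    (A : ι → MvPolynomial V ℝ) (k : ℕ) (g : MvPolynomial V ℝ) : Prop :=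
  ∃ P : Finset ι → MvPolynomial V ℝ,
    (∀ S, IsSOS (P S)) ∧
    g = ∑ S : Finset ι, P S * ∏ i ∈ S, A i ∧
    ∀ S : Finset ι, (P S * ∏ i ∈ S, A i).totalDegree ≤ k

/-- Pseudo-expectation of `f` under the finitely supported `μ`. -/
def pExpect {V : Type*} (μ : (V → ℝ) →₀ ℝ) (f : (V → ℝ) → ℝ) : ℝ :=
  ∑ z ∈ μ.support, μ z * f z

/-- `μ` is a pseudo-distribution of level `ℓ`: finitely supported, total mass one,
and nonnegative pseudo-expectation on every square of a polynomial of degree `≤ ℓ/2`. -/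
def IsPseudoDist {V : Type*} (μ : (V → ℝ) →₀ ℝ) (ℓ : ℕ) : Prop :=
  (∑ z ∈ μ.support, μ z) = 1 ∧
  ∀ p : MvPolynomial V ℝ, p.totalDegree ≤ ℓ / 2 →
    0 ≤ pExpect μ fun z => MvPolynomial.eval z p ^ 2

/-- A level-`ℓ` pseudo-distribution `μ` satisfies the system `{A i ≥ 0}` at degree `k`. -/
def PDSatisfies {V ι : Type*} [Fintype ι] [DecidableEq ι]
    (μ : (V → ℝ) →₀ ℝ) (ℓ : ℕ) (A : ι → MvPolynomial V ℝ) (k : ℕ) : Prop :=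
  ∀ (S : Finset ι) (h : MvPolynomial V ℝ), IsSOS h →
    h.totalDegree + ∑ i ∈ S, max (A i).totalDegree k ≤ ℓ →
    0 ≤ pExpect μ fun z => MvPolynomial.eval z (h * ∏ i ∈ S, A i)

/-- Euclidean norm of a finite real vector. -/
def enorm {d : ℕ} (v : Fin d → ℝ) : ℝ := Real.sqrt (∑ k, v k ^ 2)

/-- The polynomial `‖A_iᵀ v‖²` in the indeterminate `v ∈ ℝ^{dx}`. -/
def normAPoly {n dx dy : ℕ} (A : Fin n → Matrix (Fin dx) (Fin dy) ℝ) (i : Fin n) :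
    MvPolynomial (Fin dx) ℝ :=
  ∑ j, (∑ k, C (A i k j) * X k) ^ 2

/-- The polynomial `‖v‖²` in the indeterminate `v ∈ ℝ^{dx}`. -/
def vnormPoly (dx : ℕ) : MvPolynomial (Fin dx) ℝ :=
  ∑ k, (X k : MvPolynomial (Fin dx) ℝ) ^ 2

/-- The matrices `{A_i}_{i∈I}` are `k`-certifiably `(Cc, δ, M)`-anti-concentrated:
there is an even univariate polynomial `p` with `p 0 = 1` (evenness witnessed by
`q` with `p(t) = q(t²)`) such that the two anti-concentration inequalities admit
degree-`k` sum-of-squares proofs; `p(‖A_iᵀ v‖)² = q(‖A_iᵀ v‖²)²` as a polynomial in `v`. -/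
def AntiConcentrated {n dx dy : ℕ} (A : Fin n → Matrix (Fin dx) (Fin dy) ℝ)
    (I : Finset (Fin n)) (k : ℕ) (Cc δ M : ℝ) : Prop :=
  ∃ p q : Polynomial ℝ,
    (∀ t : ℝ, p.eval t = q.eval (t ^ 2)) ∧ p.eval 0 = 1 ∧
    (∀ i ∈ I,
      SosProof (fun _ : Fin 1 => C (δ ^ 2) - normAPoly A i) k
        (Polynomial.aeval (normAPoly A i) q ^ 2 - C ((1 - δ) ^ 2))) ∧
    SosProof (fun _ : Fin 1 => C (M ^ 2) - vnormPoly dx) k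
      (C (Cc * δ * M ^ 2) -
        vnormPoly dx *
          (C ((I.card : ℝ)⁻¹) * ∑ i ∈ I, Polynomial.aeval (normAPoly A i) q ^ 2))

/-- The polynomial `‖y_i − A_iᵀ x‖²` in the variables `(ω, x)`. -/
def residPoly {n dx dy : ℕ} (y : Fin n → Fin dy → ℝ)
    (A : Fin n → Matrix (Fin dx) (Fin dy) ℝ) (i : Fin n) :
    MvPolynomial (Fin n ⊕ Fin dx) ℝ :=
  ∑ j, (C (y i j) - ∑ k, C (A i k j) * X (Sum.inr k)) ^ 2

/-- The system `M_{ω,x}`: `ω_i² = ω_i` (two inequalities each),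
`c̄² − ω_i·‖y_i − A_iᵀ x‖² ≥ 0`, and the inequalities `g_j(x) ≥ 0` describing `𝕏`. -/
def sysM {n dx dy mX : ℕ} (y : Fin n → Fin dy → ℝ)
    (A : Fin n → Matrix (Fin dx) (Fin dy) ℝ)
    (g : Fin mX → MvPolynomial (Fin dx) ℝ) (cbar : ℝ) :
    Fin n ⊕ Fin n ⊕ Fin n ⊕ Fin mX → MvPolynomial (Fin n ⊕ Fin dx) ℝ
  | Sum.inl i => X (Sum.inl i) - X (Sum.inl i) ^ 2
  | Sum.inr (Sum.inl i) => X (Sum.inl i) ^ 2 - X (Sum.inl i)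
  | Sum.inr (Sum.inr (Sum.inl i)) => C (cbar ^ 2) - X (Sum.inl i) * residPoly y A i
  | Sum.inr (Sum.inr (Sum.inr j)) => rename Sum.inr (g j)

/-- The system `T_{ω,x}`: `M_{ω,x}` together with `∑ ω_i = αn` (two inequalities). -/
def sysT {n dx dy mX : ℕ} (y : Fin n → Fin dy → ℝ)
    (A : Fin n → Matrix (Fin dx) (Fin dy) ℝ)
    (g : Fin mX → MvPolynomial (Fin dx) ℝ) (cbar α : ℝ) :
    Fin 2 ⊕ (Fin n ⊕ Fin n ⊕ Fin n ⊕ Fin mX) → MvPolynomial (Fin n ⊕ Fin dx) ℝ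
  | Sum.inl j =>
      if j = 0 then C (α * n) - ∑ i, X (Sum.inl i)
      else (∑ i, (X (Sum.inl i) : MvPolynomial (Fin n ⊕ Fin dx) ℝ)) - C (α * n)
  | Sum.inr e => sysM y A g cbar e

/-- The pseudo-expectation `Ẽ_μ[ω_i]`. -/
def Eω {n dx : ℕ} (μ : (Fin n ⊕ Fin dx → ℝ) →₀ ℝ) (i : Fin n) : ℝ :=
  pExpect μ fun z => z (Sum.inl i)

/-- The vector `v_i := Ẽ_μ[ω_i·x] / Ẽ_μ[ω_i]` if `Ẽ_μ[ω_i] > 0`, else `0`. -/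
def vEst {n dx : ℕ} (μ : (Fin n ⊕ Fin dx → ℝ) →₀ ℝ) (i : Fin n) : Fin dx → ℝ :=
  if 0 < Eω μ i then
    fun k => (Eω μ i)⁻¹ * pExpect μ fun z => z (Sum.inl i) * z (Sum.inr k)
  else 0

/-- The estimate `x̂ := ∑_i (Ẽ_μ[ω_i] / ∑_j Ẽ_μ[ω_j]) · v_i`. -/
def xhat {n dx : ℕ} (μ : (Fin n ⊕ Fin dx → ℝ) →₀ ℝ) : Fin dx → ℝ :=
  fun k => ∑ i, Eω μ i / (∑ j, Eω μ j) * vEst μ i k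

theorem pExpect_eq_sum {V : Type*} (μ : (V → ℝ) →₀ ℝ) (f : (V → ℝ) → ℝ) :
    pExpect μ f = μ.sum fun z a => a * f z := rfl

theorem pExpect_add {V : Type*} (μ ν : (V → ℝ) →₀ ℝ) (f : (V → ℝ) → ℝ) :
    pExpect (μ + ν) f = pExpect μ f + pExpect ν f := by
  simp only [pExpect_eq_sum]
  exact Finsupp.sum_add_index' (fun _ => zero_mul _) fun _ _ _ => add_mul _ _ _

theorem pExpect_smul {V : Type*} (c : ℝ) (μ : (V → ℝ) →₀ ℝ) (f : (V → ℝ) → ℝ) :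
    pExpect (c • μ) f = c * pExpect μ f := by
  simp only [pExpect_eq_sum]
  rw [Finsupp.sum_smul_index fun _ => zero_mul _, Finsupp.mul_sum]
  simp only [mul_assoc]

theorem pExpect_single {V : Type*} (z : V → ℝ) (f : (V → ℝ) → ℝ) :
    pExpect (Finsupp.single z 1) f = f z := by
  rw [pExpect_eq_sum, Finsupp.sum_single_index (zero_mul _), one_mul]

theorem pExpect_const {V : Type*} (μ : (V → ℝ) →₀ ℝ) (c : ℝ) :
    pExpect μ (fun _ => c) = (∑ z ∈ μ.support, μ z) * c := by
  rw [pExpect, Finset.sum_mul]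

theorem pExpect_sub {V : Type*} (μ : (V → ℝ) →₀ ℝ) (f g : (V → ℝ) → ℝ) :
    pExpect μ (fun z => f z - g z) = pExpect μ f - pExpect μ g := by
  simp only [pExpect, mul_sub, Finset.sum_sub_distrib]

theorem pExpect_sum {V ι : Type*} (μ : (V → ℝ) →₀ ℝ) (s : Finset ι)
    (f : ι → (V → ℝ) → ℝ) :
    pExpect μ (fun z => ∑ i ∈ s, f i z) = ∑ i ∈ s, pExpect μ (f i) := by
  simp only [pExpect, Finset.mul_sum]
  exact Finset.sum_comm

theorem IsSOS.eval_nonneg {V : Type*} {p : MvPolynomial V ℝ} (hp : IsSOS p) (z : V → ℝ) :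
    0 ≤ MvPolynomial.eval z p := by
  obtain ⟨N, q, rfl⟩ := hp
  rw [map_sum]
  exact Finset.sum_nonneg fun j _ => by rw [map_pow]; exact sq_nonneg _

theorem isSOS_one {V : Type*} : IsSOS (1 : MvPolynomial V ℝ) := ⟨1, fun _ => 1, by simp⟩

/-- The pseudo-distribution obtained by moving a fraction `t` of the mass of `μ` to the point `z`. -/
def mixPoint {V : Type*} (μ : (V → ℝ) →₀ ℝ) (t : ℝ) (z : V → ℝ) : (V → ℝ) →₀ ℝ :=
  (1 - t) • μ + t • Finsupp.single z 1

theorem pExpect_mixPoint {V : Type*} (μ : (V → ℝ) →₀ ℝ) (t : ℝ) (z : V → ℝ)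
    (f : (V → ℝ) → ℝ) :
    pExpect (mixPoint μ t z) f = (1 - t) * pExpect μ f + t * f z := by
  rw [mixPoint, pExpect_add, pExpect_smul, pExpect_smul, pExpect_single]

theorem IsPseudoDist.mixPoint {V : Type*} {μ : (V → ℝ) →₀ ℝ} {ℓ : ℕ}
    (h : IsPseudoDist μ ℓ) {t : ℝ} (ht0 : 0 ≤ t) (ht1 : t ≤ 1) (z : V → ℝ) :
    IsPseudoDist (mixPoint μ t z) ℓ := by
  constructor
  · have h1 := pExpect_mixPoint μ t z fun _ => 1
    rw [pExpect_const, pExpect_const, h.1] at h1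
    linarith
  · intro p hp
    rw [pExpect_mixPoint]
    exact add_nonneg (mul_nonneg (sub_nonneg.2 ht1) (h.2 p hp)) (mul_nonneg ht0 (sq_nonneg _))

theorem PDSatisfies.mixPoint {V ι : Type*} [Fintype ι] [DecidableEq ι]
    {μ : (V → ℝ) →₀ ℝ} {ℓ : ℕ} {A : ι → MvPolynomial V ℝ} {k : ℕ}
    (h : PDSatisfies μ ℓ A k) {t : ℝ} (ht0 : 0 ≤ t) (ht1 : t ≤ 1) {z : V → ℝ}
    (hz : ∀ i, 0 ≤ MvPolynomial.eval z (A i)) :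
    PDSatisfies (mixPoint μ t z) ℓ A k := by
  intro S p hp hdeg
  rw [pExpect_mixPoint]
  refine add_nonneg (mul_nonneg (sub_nonneg.2 ht1) (h S p hp hdeg)) (mul_nonneg ht0 ?_)
  rw [map_mul, map_prod]
  exact mul_nonneg (hp.eval_nonneg z) (Finset.prod_nonneg fun i _ => hz i)

theorem PDSatisfies.pExpect_nonneg {V ι : Type*} [Fintype ι] [DecidableEq ι]
    {μ : (V → ℝ) →₀ ℝ} {ℓ : ℕ} {A : ι → MvPolynomial V ℝ}
    (h : PDSatisfies μ ℓ A 0) {i : ι} (hi : (A i).totalDegree ≤ ℓ) :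
    0 ≤ pExpect μ fun z => MvPolynomial.eval z (A i) := by
  simpa using h {i} 1 isSOS_one (by simpa using hi)

/-- The point of `ℝⁿ × ℝ^{dx}` given by the indicator of the inliers and the ground truth. -/
def inlierPoint {n dx : ℕ} (I : Finset (Fin n)) (x0 : Fin dx → ℝ) : Fin n ⊕ Fin dx → ℝ :=
  Sum.elim (fun i => if i ∈ I then 1 else 0) x0

theorem eval_sysT_inlierPoint_nonneg {n dx dy mX : ℕ} (y : Fin n → Fin dy → ℝ)
    (A : Fin n → Matrix (Fin dx) (Fin dy) ℝ) (g : Fin mX → MvPolynomial (Fin dx) ℝ)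
    {cbar α : ℝ} {I : Finset (Fin n)} {x0 : Fin dx → ℝ}
    (hx0 : ∀ j, 0 ≤ MvPolynomial.eval x0 (g j)) (hcbar : 0 ≤ cbar)
    (hIcard : (I.card : ℝ) = α * n)
    (hinlier : ∀ i ∈ I, _root_.enorm (fun j => y i j - ∑ k, A i k j * x0 k) ≤ cbar)
    (e : Fin 2 ⊕ (Fin n ⊕ Fin n ⊕ Fin n ⊕ Fin mX)) :
    0 ≤ MvPolynomial.eval (inlierPoint I x0) (sysT y A g cbar α e) := by
  rcases e with j | i | i | i | j
  · by_cases hj : j = 0 <;> simp [sysT, hj, inlierPoint, hIcard]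
  · by_cases hi : i ∈ I <;> simp [sysT, sysM, inlierPoint, hi]
  · by_cases hi : i ∈ I <;> simp [sysT, sysM, inlierPoint, hi]
  · by_cases hi : i ∈ I
    · simpa [sysT, sysM, inlierPoint, hi, residPoly] using
        (Real.sqrt_le_left hcbar).1 (hinlier i hi)
    · simpa [sysT, sysM, inlierPoint, hi] using sq_nonneg cbar
  · simpa [sysT, sysM, inlierPoint, MvPolynomial.eval_rename, Function.comp_def] using hx0 j

theorem PDSatisfies.card_le_sum_Eω {n dx dy mX : ℕ} {y : Fin n → Fin dy → ℝ}
    {A : Fin n → Matrix (Fin dx) (Fin dy) ℝ} {g : Fin mX → MvPolynomial (Fin dx) ℝ}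
    {cbar α : ℝ} {ℓ : ℕ} (hℓ : 1 ≤ ℓ) {μ : (Fin n ⊕ Fin dx → ℝ) →₀ ℝ}
    (hmass : ∑ z ∈ μ.support, μ z = 1) (hsat : PDSatisfies μ ℓ (sysT y A g cbar α) 0) :
    α * n ≤ ∑ i, Eω μ i := by
  have hdeg : (sysT y A g cbar α (Sum.inl 1)).totalDegree ≤ ℓ := by
    refine le_trans ?_ hℓ
    simp only [sysT, one_ne_zero, if_false]
    refine (totalDegree_sub_C_le _ _).trans (totalDegree_finsetSum_le fun i _ => ?_)
    exact (totalDegree_X _).le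
  have h := hsat.pExpect_nonneg hdeg
  simp only [sysT, one_ne_zero, if_false, map_sub, map_sum, eval_X, eval_C] at h
  rw [pExpect_sub, pExpect_sum, pExpect_const, hmass, one_mul] at h
  exact sub_nonneg.1 h

/-- If `u` has minimal Euclidean norm on the segment from `u` to `v`, then `‖u‖² ≤ ⟨u, v⟩`. -/
theorem sum_sq_le_sum_mul_of_segment_min {ι : Type*} [Fintype ι] (u v : ι → ℝ)
    (h : ∀ t : ℝ, 0 ≤ t → t ≤ 1 → ∑ i, u i ^ 2 ≤ ∑ i, ((1 - t) * u i + t * v i) ^ 2) :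
    ∑ i, u i ^ 2 ≤ ∑ i, u i * v i := by
  by_contra! hlt
  set a := ∑ i, u i ^ 2
  set b := ∑ i, u i * v i
  set d := ∑ i, (v i - u i) ^ 2
  have hd : 0 ≤ d := Finset.sum_nonneg fun i _ => sq_nonneg _
  have hexp : ∀ t : ℝ, ∑ i, ((1 - t) * u i + t * v i) ^ 2 = a + 2 * t * (b - a) + t ^ 2 * d := by
    intro t
    simp only [a, b, d, ← Finset.sum_sub_distrib, Finset.mul_sum, ← Finset.sum_add_distrib]
    exact Finset.sum_congr rfl fun i _ => by ring
  have hs : 0 < a - b := sub_pos.2 hlt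
  have hsd : 0 < d + (a - b) := by linarith
  set t := (a - b) / (d + (a - b))
  have ht : 0 < t := div_pos hs hsd
  have ht1 : t ≤ 1 := (div_le_one hsd).2 (by linarith)
  have htd : t * (d + (a - b)) = a - b := div_mul_cancel₀ _ hsd.ne'
  have hmin := h t ht.le ht1
  rw [hexp] at hmin
  have hle : t * d ≤ a - b := by nlinarith
  nlinarith [mul_le_mul_of_nonneg_left hle ht.le, mul_pos ht hs]

/-- An `‖Ẽ[ω]‖`-minimizing level-`ℓ` pseudo-distribution (`ℓ ≥ 2`) satisfying
`T_{ω,x}` at degree `0` spreads weight at least `α²·n` over the inliers. -/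
theorem min_norm_spreads_over_inliers
    {n dx dy mX : ℕ} (hn : 0 < n) (hdx : 0 < dx) (hdy : 0 < dy)
    (y : Fin n → Fin dy → ℝ) (A : Fin n → Matrix (Fin dx) (Fin dy) ℝ)
    (g : Fin mX → MvPolynomial (Fin dx) ℝ)
    (Mx : ℝ) (hMx : 0 < Mx)
    (j0 : Fin mX) (hj0 : g j0 = C (Mx ^ 2) - vnormPoly dx)
    (x0 : Fin dx → ℝ) (hx0 : ∀ j, 0 ≤ MvPolynomial.eval x0 (g j))
    (cbar : ℝ) (hcbar : 0 ≤ cbar)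
    (α : ℝ) (hα0 : 0 < α) (hα1 : α ≤ 1)
    (I : Finset (Fin n)) (hIcard : (I.card : ℝ) = α * n)
    (hinlier : ∀ i ∈ I, _root_.enorm (fun j => y i j - ∑ k, A i k j * x0 k) ≤ cbar)
    (ℓ : ℕ) (hℓ : 2 ≤ ℓ)
    (μ : (Fin n ⊕ Fin dx → ℝ) →₀ ℝ)
    (hpd : IsPseudoDist μ ℓ)
    (hsat : PDSatisfies μ ℓ (sysT y A g cbar α) 0)
    (hmin : ∀ ν : (Fin n ⊕ Fin dx → ℝ) →₀ ℝ, IsPseudoDist ν ℓ →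
      PDSatisfies ν ℓ (sysT y A g cbar α) 0 →
      _root_.enorm (fun i => Eω μ i) ≤ _root_.enorm (fun i => Eω ν i)) :
    α ^ 2 * n ≤ ∑ i ∈ I, Eω μ i := by
  have hEmix : ∀ t i, Eω (mixPoint μ t (inlierPoint I x0)) i =
      (1 - t) * Eω μ i + t * if i ∈ I then 1 else 0 := fun t i => pExpect_mixPoint _ _ _ _
  have hproj : ∑ i, Eω μ i ^ 2 ≤ ∑ i, Eω μ i * if i ∈ I then 1 else 0 := by
    refine sum_sq_le_sum_mul_of_segment_min _ _ fun t ht0 ht1 => ?_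
    have h := hmin _ (hpd.mixPoint ht0 ht1 (inlierPoint I x0)) (hsat.mixPoint ht0 ht1
      (eval_sysT_inlierPoint_nonneg y A g hx0 hcbar hIcard hinlier))
    simp only [hEmix] at h
    exact (Real.sqrt_le_sqrt_iff (Finset.sum_nonneg fun i _ => sq_nonneg _)).1 h
  have hsum := hsat.card_le_sum_Eω (by omega) hpd.1
  have hcs : (∑ i, Eω μ i) ^ 2 ≤ n * ∑ i, Eω μ i ^ 2 := by
    simpa using sq_sum_le_card_mul_sum_sq (s := Finset.univ) (f := Eω μ)
  have hn' : (0 : ℝ) < n := Nat.cast_pos.2 hn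
  have hsq : (α * n) ^ 2 ≤ (∑ i, Eω μ i) ^ 2 := pow_le_pow_left₀ (by positivity) hsum 2
  have hnorm : α ^ 2 * n ≤ ∑ i, Eω μ i ^ 2 :=
    le_of_mul_le_mul_left (by linarith [hsq.trans hcs]) hn'
  simpa using hnorm.trans hproj
end
end

section
/- Suppose c̄ > 0 and let γ° := ∑_{i∈I} ‖y_i − A_iᵀ x°‖². Then every TLS-optimal x_TLS selects at least αn − γ°/c̄² measurements within the error threshold: |{i ∈ {1,…,n} : ‖y_i − A_iᵀ x_TLS‖ ≤ c̄}| ≥ αn − γ°/c̄². -/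
open scoped BigOperators

noncomputable section

/-- Residual `‖y_i − A_iᵀ x‖` of `x` at measurement `i`. -/
def resid {n dx dy : ℕ} (y : Fin n → Fin dy → ℝ)
    (A : Fin n → Matrix (Fin dx) (Fin dy) ℝ) (x : Fin dx → ℝ) (i : Fin n) : ℝ :=
  enorm fun j => y i j - ∑ k, A i k j * x k

/-- Feasibility for the (MC) problem. -/
def MCFeasible {n dx dy : ℕ} (y : Fin n → Fin dy → ℝ)
    (A : Fin n → Matrix (Fin dx) (Fin dy) ℝ) (𝕏 : Set (Fin dx → ℝ)) (cbar : ℝ)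
    (ω : Fin n → ℝ) (x : Fin dx → ℝ) : Prop :=
  (∀ i, ω i = 0 ∨ ω i = 1) ∧ x ∈ 𝕏 ∧ ∀ i, ω i * resid y A x i ^ 2 ≤ cbar ^ 2

/-- `(x, ω)` is an optimal solution of (MC). -/
def MCOptimal {n dx dy : ℕ} (y : Fin n → Fin dy → ℝ)
    (A : Fin n → Matrix (Fin dx) (Fin dy) ℝ) (𝕏 : Set (Fin dx → ℝ)) (cbar : ℝ)
    (ω : Fin n → ℝ) (x : Fin dx → ℝ) : Prop :=
  MCFeasible y A 𝕏 cbar ω x ∧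
    ∀ ω' x', MCFeasible y A 𝕏 cbar ω' x' → ∑ i, ω' i ≤ ∑ i, ω i

/-- The (TLS) objective. -/
def tlsObj {n dx dy : ℕ} (y : Fin n → Fin dy → ℝ)
    (A : Fin n → Matrix (Fin dx) (Fin dy) ℝ) (cbar : ℝ) (x : Fin dx → ℝ) : ℝ :=
  ∑ i, min (resid y A x i ^ 2) (cbar ^ 2)

/-- `x` is an optimal solution of (TLS). -/
def TLSOptimal {n dx dy : ℕ} (y : Fin n → Fin dy → ℝ)
    (A : Fin n → Matrix (Fin dx) (Fin dy) ℝ) (𝕏 : Set (Fin dx → ℝ)) (cbar : ℝ)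
    (x : Fin dx → ℝ) : Prop :=
  x ∈ 𝕏 ∧ ∀ x' ∈ 𝕏, tlsObj y A cbar x ≤ tlsObj y A cbar x'

/-- A set `J` of measurement indices is nondegenerate: the least-squares problem
over `J` admits a unique minimizer on `𝕏`. -/
def Nondegenerate {n dx dy : ℕ} (y : Fin n → Fin dy → ℝ)
    (A : Fin n → Matrix (Fin dx) (Fin dy) ℝ) (𝕏 : Set (Fin dx → ℝ))
    (J : Finset (Fin n)) : Prop :=
  ∃! x, x ∈ 𝕏 ∧ ∀ x' ∈ 𝕏, ∑ i ∈ J, resid y A x i ^ 2 ≤ ∑ i ∈ J, resid y A x' i ^ 2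

/-- Smallest singular value of the matrix stacking the blocks `A_iᵀ`, `i ∈ J`. -/
def sigmaMin {n dx dy : ℕ} (A : Fin n → Matrix (Fin dx) (Fin dy) ℝ)
    (J : Finset (Fin n)) : ℝ :=
  sInf { s | ∃ v : Fin dx → ℝ, _root_.enorm v = 1 ∧
    s = Real.sqrt (∑ i ∈ J, ∑ j, (∑ k, A i k j * v k) ^ 2) }

/-- Replacing the truncated squared residuals outside `I` by `cbar ^ 2` bounds the objective. -/
theorem tlsObj_le_sum_add {n dx dy : ℕ} (y : Fin n → Fin dy → ℝ)
    (A : Fin n → Matrix (Fin dx) (Fin dy) ℝ) (cbar : ℝ) (x : Fin dx → ℝ) (I : Finset (Fin n)) :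
    tlsObj y A cbar x ≤ ∑ i ∈ I, resid y A x i ^ 2 + ((n : ℝ) - I.card) * cbar ^ 2 := by
  have hcompl : ((n : ℝ) - I.card) = (Iᶜ.card : ℝ) := by
    rw [Finset.card_compl, Nat.cast_sub (Finset.card_le_univ _), Fintype.card_fin]
  rw [tlsObj, ← Finset.sum_add_sum_compl I, hcompl, ← nsmul_eq_mul, ← Finset.sum_const]
  exact add_le_add (Finset.sum_le_sum fun i _ => min_le_left _ _)
    (Finset.sum_le_sum fun i _ => min_le_right _ _)

/-- Each measurement outside the error threshold contributes `cbar ^ 2` to the objective. -/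
theorem card_mul_sq_le_tlsObj {n dx dy : ℕ} (y : Fin n → Fin dy → ℝ)
    (A : Fin n → Matrix (Fin dx) (Fin dy) ℝ) {cbar : ℝ} (hcbar : 0 ≤ cbar) (x : Fin dx → ℝ) :
    ((n : ℝ) - (Finset.univ.filter fun i => resid y A x i ≤ cbar).card) * cbar ^ 2 ≤
      tlsObj y A cbar x := by
  set K := Finset.univ.filter fun i => resid y A x i ≤ cbar with hK
  have hcompl : ((n : ℝ) - K.card) = (Kᶜ.card : ℝ) := by
    rw [Finset.card_compl, Nat.cast_sub (Finset.card_le_univ _), Fintype.card_fin]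
  rw [tlsObj, ← Finset.sum_add_sum_compl K, hcompl, ← nsmul_eq_mul, ← Finset.sum_const]
  refine le_add_of_nonneg_of_le (Finset.sum_nonneg fun i _ => by positivity)
    (Finset.sum_le_sum fun i hi => le_min ?_ le_rfl)
  have hlt : cbar < resid y A x i := by simpa [hK] using hi
  exact pow_le_pow_left₀ hcbar hlt.le 2

/-- Every TLS-optimal solution selects at least `αn − γ°/c̄²` measurements
within the error threshold `c̄`. -/
theorem tls_selects_enough_inliers
    {n dx dy : ℕ} (hn : 0 < n) (hdx : 0 < dx) (hdy : 0 < dy)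
    (y : Fin n → Fin dy → ℝ) (A : Fin n → Matrix (Fin dx) (Fin dy) ℝ)
    (𝕏 : Set (Fin dx → ℝ)) (x0 : Fin dx → ℝ) (hx0 : x0 ∈ 𝕏)
    (cbar : ℝ) (hcbar : 0 < cbar)
    (α : ℝ) (hα0 : 0 < α) (hα1 : α ≤ 1)
    (I : Finset (Fin n)) (hIcard : (I.card : ℝ) = α * n)
    (hinlier : ∀ i ∈ I, resid y A x0 i ≤ cbar)
    (γ0 : ℝ) (hγ0 : γ0 = ∑ i ∈ I, resid y A x0 i ^ 2)
    (xTLS : Fin dx → ℝ) (hopt : TLSOptimal y A 𝕏 cbar xTLS) :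
    α * n - γ0 / cbar ^ 2 ≤
      ((Finset.univ.filter fun i => resid y A xTLS i ≤ cbar).card : ℝ) := by
  have hle := (card_mul_sq_le_tlsObj y A hcbar.le xTLS).trans
    ((hopt.2 x0 hx0).trans (tlsObj_le_sum_add y A cbar x0 I))
  have hsq : 0 < cbar ^ 2 := pow_pos hcbar 2
  rw [← hγ0, hIcard] at hle
  rw [sub_le_iff_le_add', ← sub_le_iff_le_add, le_div_iff₀ hsq]
  linarith
end
end
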